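/- arXiv:1305.5681 — 9 statements merged into one kernel-verified Lean document; each statement's English description precedes it below -/
import Mathlib

section
/- Let b > 0 and let α : ℝ → ℝ² be the parabola α(t) = (b sinh²(t), 2b sinh(t)). Then for all t₀ ≤ t, the arc length of α from t₀ to t satisfies ∫_{t₀}^{t} ‖α'(u)‖ du = b(t + sinh(t)cosh(t)) − b(t₀ + sinh(t₀)cosh(t₀)). -/
theorem hasDerivAt_parabola (b u : ℝ) :
    HasDerivAt (fun t => WithLp.toLp 2 ![b * Real.sinh t ^ 2, 2 * b * Real.sinh t])
      (WithLp.toLp 2 ![2 * b * Real.sinh u * Real.cosh u, 2 * b * Real.cosh u]) u := by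
  have h : HasDerivAt (fun t => ![b * Real.sinh t ^ 2, 2 * b * Real.sinh t])
      ![2 * b * Real.sinh u * Real.cosh u, 2 * b * Real.cosh u] u := by
    refine hasDerivAt_pi.2 fun i => ?_
    fin_cases i
    · refine (((Real.hasDerivAt_sinh u).pow 2).const_mul b).congr_deriv ?_
      simp
      ring
    · exact (Real.hasDerivAt_sinh u).const_mul (2 * b)
  exact ((PiLp.continuousLinearEquiv 2 ℝ fun _ : Fin 2 => ℝ).symm.hasFDerivAt.comp_hasDerivAt u h)

theorem norm_parabola_velocity {b : ℝ} (hb : 0 ≤ b) (u : ℝ) :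
    ‖(WithLp.toLp 2 ![2 * b * Real.sinh u * Real.cosh u, 2 * b * Real.cosh u] :
      EuclideanSpace ℝ (Fin 2))‖ = 2 * b * Real.cosh u ^ 2 := by
  rw [EuclideanSpace.norm_eq, Real.sqrt_eq_iff_mul_self_eq (by positivity) (by positivity)]
  simp only [Fin.sum_univ_two, Real.norm_eq_abs, sq_abs, Matrix.cons_val_zero, Matrix.cons_val_one]
  linear_combination (-4) * b ^ 2 * Real.cosh u ^ 2 * Real.cosh_sq u

/-- Arc length of the parabola `α(t) = (b sinh²(t), 2b sinh(t))`. -/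
theorem parabola_arclength
    (b : ℝ) (hb : 0 < b) (α : ℝ → EuclideanSpace ℝ (Fin 2))
    (hα : α = fun t => (WithLp.equiv 2 (Fin 2 → ℝ)).symm
      ![b * Real.sinh t ^ 2, 2 * b * Real.sinh t]) :
    ∀ t₀ t : ℝ, t₀ ≤ t →
      (∫ u in t₀..t, ‖deriv α u‖) =
        b * (t + Real.sinh t * Real.cosh t) - b * (t₀ + Real.sinh t₀ * Real.cosh t₀) := by
  intro t₀ t _
  have hnorm : (fun u => ‖deriv α u‖) = fun u => 2 * b * Real.cosh u ^ 2 := by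
    funext u
    subst hα
    rw [← norm_parabola_velocity hb.le]
    exact congrArg norm (hasDerivAt_parabola b u).deriv
  rw [hnorm]
  refine intervalIntegral.integral_eq_sub_of_hasDerivAt
    (f := fun u => b * (u + Real.sinh u * Real.cosh u)) (fun u _ => ?_)
    (Continuous.intervalIntegrable (by fun_prop) _ _)
  refine (((hasDerivAt_id u).add
    ((Real.hasDerivAt_sinh u).mul (Real.hasDerivAt_cosh u))).const_mul b).congr_deriv ?_
  linear_combination -b * Real.cosh_sq u
end

section
/- Let 0 < b < a, c = √(a² − b²), and fix t₀ ∈ ℝ. Define the undulary B₁(t) = (g(t), f(t)) where g(t) = ∫_{t₀}^{t} √(a² − c² cos²(z)) dz − c sin(t)(a − c cos(t))/√(a² − c² cos²(t)) and f(t) = b(a − c cos(t))/√(a² − c² cos²(t)). Then B₁ is differentiable and ‖B₁'(t)‖ = ab/(a + c cos(t)) for every t. -/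
/-- Derivative of `√(a² - c² cos²)`, the speed of the ellipse parametrization. -/
lemma hasDerivAt_sqrt_sub_cos_sq {a c t : ℝ} (h : 0 < a ^ 2 - c ^ 2 * Real.cos t ^ 2) :
    HasDerivAt (fun z => Real.sqrt (a ^ 2 - c ^ 2 * Real.cos z ^ 2))
      (c ^ 2 * Real.cos t * Real.sin t / Real.sqrt (a ^ 2 - c ^ 2 * Real.cos t ^ 2)) t := by
  have h1 := ((((Real.hasDerivAt_cos t).pow 2).const_mul (c ^ 2)).const_sub (a ^ 2)).sqrt h.ne'
  refine h1.congr_deriv ?_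
  have := (Real.sqrt_pos.2 h).ne'
  simp only [Pi.pow_apply] at *
  field_simp
  ring

/-- The height of the focus above the line has derivative `ab c sin t (a - c cos t) / W³`,
where `W = √(a² - c² cos² t)`. -/
lemma hasDerivAt_focus_height {a c t : ℝ} (b : ℝ) (h : 0 < a ^ 2 - c ^ 2 * Real.cos t ^ 2) :
    HasDerivAt (fun t => b * (a - c * Real.cos t) / Real.sqrt (a ^ 2 - c ^ 2 * Real.cos t ^ 2))
      (a * b * (c * Real.sin t) * (a - c * Real.cos t) /
        Real.sqrt (a ^ 2 - c ^ 2 * Real.cos t ^ 2) ^ 3) t := by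
  have hW := (Real.sqrt_pos.2 h).ne'
  have hsq := Real.sq_sqrt h.le
  refine (((((Real.hasDerivAt_cos t).const_mul c).const_sub a).const_mul b).div
    (hasDerivAt_sqrt_sub_cos_sq h) hW).congr_deriv ?_
  set W := Real.sqrt (a ^ 2 - c ^ 2 * Real.cos t ^ 2)
  field_simp
  rw [hsq]
  ring

/-- The abscissa of the focus has derivative `ab² (a - c cos t) / W³`,
where `W = √(a² - c² cos² t)`. -/
lemma hasDerivAt_focus_abscissa {a b c t : ℝ} (t₀ : ℝ) (hc : c ^ 2 = a ^ 2 - b ^ 2)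
    (h : 0 < a ^ 2 - c ^ 2 * Real.cos t ^ 2) :
    HasDerivAt (fun t => (∫ z in t₀..t, Real.sqrt (a ^ 2 - c ^ 2 * Real.cos z ^ 2)) -
      c * Real.sin t * (a - c * Real.cos t) / Real.sqrt (a ^ 2 - c ^ 2 * Real.cos t ^ 2))
      (a * b ^ 2 * (a - c * Real.cos t) /
        Real.sqrt (a ^ 2 - c ^ 2 * Real.cos t ^ 2) ^ 3) t := by
  have hcont : Continuous fun z => Real.sqrt (a ^ 2 - c ^ 2 * Real.cos z ^ 2) := by fun_prop
  have hW := (Real.sqrt_pos.2 h).ne'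
  have hsq := Real.sq_sqrt h.le
  refine ((hcont.integral_hasStrictDerivAt t₀ t).hasDerivAt.sub
    ((((Real.hasDerivAt_sin t).const_mul c).mul
      (((Real.hasDerivAt_cos t).const_mul c).const_sub a)).div
      (hasDerivAt_sqrt_sub_cos_sq h) hW)).congr_deriv ?_
  simp only [Pi.mul_apply]
  set W := Real.sqrt (a ^ 2 - c ^ 2 * Real.cos t ^ 2)
  have hb : b ^ 2 = a ^ 2 - c ^ 2 := by linarith
  have hW4 : W ^ 4 = (a ^ 2 - c ^ 2 * Real.cos t ^ 2) ^ 2 := by rw [← hsq]; ring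
  have hs := Real.sin_sq t
  field_simp
  ring_nf
  simp only [hsq, hW4, hs, hb]
  ring

/-- The undulary `B₁`, the roulette of the focus of an ellipse nearest the tangent line,
is differentiable with speed `ab/(a + c cos t)`. -/
theorem undulary_B1_speed
    (a b c t₀ : ℝ) (hb : 0 < b) (hba : b < a) (hc : c = Real.sqrt (a ^ 2 - b ^ 2))
    (g f : ℝ → ℝ)
    (hg : g = fun t => (∫ z in t₀..t, Real.sqrt (a ^ 2 - c ^ 2 * Real.cos z ^ 2)) -
      c * Real.sin t * (a - c * Real.cos t) / Real.sqrt (a ^ 2 - c ^ 2 * Real.cos t ^ 2))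
    (hf : f = fun t => b * (a - c * Real.cos t) / Real.sqrt (a ^ 2 - c ^ 2 * Real.cos t ^ 2))
    (B₁ : ℝ → EuclideanSpace ℝ (Fin 2))
    (hB : B₁ = fun t => (WithLp.equiv 2 (Fin 2 → ℝ)).symm ![g t, f t]) :
    Differentiable ℝ B₁ ∧ ∀ t : ℝ, ‖deriv B₁ t‖ = a * b / (a + c * Real.cos t) := by
  have hc2 : c ^ 2 = a ^ 2 - b ^ 2 := by
    rw [hc, Real.sq_sqrt]
    nlinarith
  have hc0 : 0 ≤ c := hc ▸ Real.sqrt_nonneg _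
  have hca : c < a := by nlinarith
  have hminus (t : ℝ) : 0 < a - c * Real.cos t := by nlinarith [Real.cos_le_one t]
  have hplus (t : ℝ) : 0 < a + c * Real.cos t := by nlinarith [Real.neg_one_le_cos t]
  have hpos (t : ℝ) : 0 < a ^ 2 - c ^ 2 * Real.cos t ^ 2 := by
    nlinarith [mul_pos (hminus t) (hplus t)]
  have key (t : ℝ) : HasDerivAt B₁ (WithLp.toLp 2
      ![a * b ^ 2 * (a - c * Real.cos t) / Real.sqrt (a ^ 2 - c ^ 2 * Real.cos t ^ 2) ^ 3,
        a * b * (c * Real.sin t) * (a - c * Real.cos t) /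
          Real.sqrt (a ^ 2 - c ^ 2 * Real.cos t ^ 2) ^ 3]) t := by
    subst hB
    refine (PiLp.continuousLinearEquiv 2 ℝ fun _ : Fin 2 => ℝ).symm.hasFDerivAt.comp_hasDerivAt t
      (hasDerivAt_pi.2 fun i => ?_)
    fin_cases i
    · simpa [hg] using hasDerivAt_focus_abscissa t₀ hc2 (hpos t)
    · simpa [hf] using hasDerivAt_focus_height b (hpos t)
  refine ⟨fun t => (key t).differentiableAt, fun t => ?_⟩
  have hp := hplus t
  have hW := Real.sqrt_pos.2 (hpos t)
  have hsq := Real.sq_sqrt (hpos t).le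
  rw [(key t).deriv, EuclideanSpace.norm_eq,
    Real.sqrt_eq_iff_eq_sq (by positivity) (by have := hb.trans hba; positivity)]
  simp only [Fin.sum_univ_two, Real.norm_eq_abs, sq_abs, Matrix.cons_val_zero, Matrix.cons_val_one]
  set W := Real.sqrt (a ^ 2 - c ^ 2 * Real.cos t ^ 2)
  have hfac : W ^ 2 = (a - c * Real.cos t) * (a + c * Real.cos t) := by rw [hsq]; ring
  have hsum : b ^ 2 + (c * Real.sin t) ^ 2 = W ^ 2 := by
    rw [hsq, mul_pow, Real.sin_sq]
    linarith
  calc _ = (a * b * (a - c * Real.cos t)) ^ 2 * (b ^ 2 + (c * Real.sin t) ^ 2) / (W ^ 2) ^ 3 := by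
        ring
    _ = (a * b / (a + c * Real.cos t)) ^ 2 := by
        have := (hminus t).ne'
        rw [hsum, hfac]
        field_simp
end

section
/- Let 0 < b < a and c = √(a² − b²). Then ∫_{−π/2}^{π/2} ab/(a + c cos(t)) dt + ∫_{−π/2}^{π/2} ab/(a − c cos(t)) dt = 2πa. -/
open Real in
theorem mul_sin_sq_add_mul_cos_sq_pos {a b : ℝ} (ha : 0 < a) (hb : 0 < b) (t : ℝ) :
    0 < a * sin t ^ 2 + b * cos t ^ 2 := by
  rcases le_total a b with h | h <;>
    nlinarith [sq_nonneg (sin t), sq_nonneg (cos t), sin_sq_add_cos_sq t]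

open Real in
/-- A smooth antiderivative of `a b / (a² sin² t + b² cos² t)` on the whole line: the continuous
branch of `arctan ((a / b) * tan t)`. -/
theorem hasDerivAt_add_arctan_sin_mul_cos {a b : ℝ} (ha : 0 < a) (hb : 0 < b) (t : ℝ) :
    HasDerivAt
      (fun t => t + arctan ((a - b) * (sin t * cos t) / (b * cos t ^ 2 + a * sin t ^ 2)))
      (a * b / (a ^ 2 * sin t ^ 2 + b ^ 2 * cos t ^ 2)) t := by
  have hsc := sin_sq_add_cos_sq t
  have hD : 0 < b * cos t ^ 2 + a * sin t ^ 2 := by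
    simpa only [add_comm] using mul_sin_sq_add_mul_cos_sq_pos ha hb t
  have hE := mul_sin_sq_add_mul_cos_sq_pos (pow_pos ha 2) (pow_pos hb 2) t
  have hs := hasDerivAt_sin t
  have hc := hasDerivAt_cos t
  have hquot := ((hs.mul hc).const_mul (a - b)).div
    (((hc.pow 2).const_mul b).add ((hs.pow 2).const_mul a)) hD.ne'
  refine ((hasDerivAt_id t).add hquot.arctan).congr_deriv ?_
  have hsum : (b * cos t ^ 2 + a * sin t ^ 2) ^ 2 + ((a - b) * (sin t * cos t)) ^ 2 =
      a ^ 2 * sin t ^ 2 + b ^ 2 * cos t ^ 2 := by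
    linear_combination (a ^ 2 * sin t ^ 2 + b ^ 2 * cos t ^ 2) * hsc
  have hinv : 1 / (1 + ((a - b) * (sin t * cos t) / (b * cos t ^ 2 + a * sin t ^ 2)) ^ 2) =
      (b * cos t ^ 2 + a * sin t ^ 2) ^ 2 / (a ^ 2 * sin t ^ 2 + b ^ 2 * cos t ^ 2) := by
    rw [← hsum] at hE ⊢
    have := hE.ne'
    field_simp
  simp only [Pi.mul_apply, Pi.add_apply, Pi.pow_apply, Pi.div_apply]
  rw [hinv]
  field_simp
  simp only [Nat.cast_ofNat, Nat.add_one_sub_one, pow_one]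
  linear_combination ((a - b) * (b * cos t ^ 2 - a * sin t ^ 2) + a * b) * hsc

open Real in
theorem integral_mul_div_sq_mul_sin_sq_add_sq_mul_cos_sq {a b : ℝ} (ha : 0 < a) (hb : 0 < b) :
    ∫ t in (-(π / 2))..(π / 2), a * b / (a ^ 2 * sin t ^ 2 + b ^ 2 * cos t ^ 2) = π := by
  have hcont : Continuous fun t => a * b / (a ^ 2 * sin t ^ 2 + b ^ 2 * cos t ^ 2) :=
    continuous_const.div (by fun_prop) fun t =>
      (mul_sin_sq_add_mul_cos_sq_pos (pow_pos ha 2) (pow_pos hb 2) t).ne'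
  rw [intervalIntegral.integral_eq_sub_of_hasDerivAt
    (fun t _ => hasDerivAt_add_arctan_sin_mul_cos ha hb t)
    (hcont.intervalIntegrable _ _)]
  simp

/-- The lengths of the two undulary roulettes for `t ∈ (−π/2, π/2)` sum to `2πa`. -/
theorem undulary_lengths_sum
    (a b c : ℝ) (hb : 0 < b) (hba : b < a) (hc : c = Real.sqrt (a ^ 2 - b ^ 2)) :
    (∫ t in (-(Real.pi / 2))..(Real.pi / 2), a * b / (a + c * Real.cos t)) +
      (∫ t in (-(Real.pi / 2))..(Real.pi / 2), a * b / (a - c * Real.cos t)) =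
      2 * Real.pi * a := by
  have ha : 0 < a := hb.trans hba
  have hc0 : 0 ≤ c := hc ▸ Real.sqrt_nonneg _
  have hc2 : c ^ 2 = a ^ 2 - b ^ 2 := by rw [hc, Real.sq_sqrt (by nlinarith)]
  have hca : c < a := by nlinarith
  have hplus (t : ℝ) : 0 < a + c * Real.cos t := by nlinarith [Real.neg_one_le_cos t]
  have hminus (t : ℝ) : 0 < a - c * Real.cos t := by nlinarith [Real.cos_le_one t]
  have hadd (t : ℝ) : a * b / (a + c * Real.cos t) + a * b / (a - c * Real.cos t) =
      2 * a * (a * b / (a ^ 2 * Real.sin t ^ 2 + b ^ 2 * Real.cos t ^ 2)) := by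
    have hprod : a ^ 2 * Real.sin t ^ 2 + b ^ 2 * Real.cos t ^ 2 =
        (a + c * Real.cos t) * (a - c * Real.cos t) := by
      linear_combination a ^ 2 * Real.sin_sq_add_cos_sq t + Real.cos t ^ 2 * hc2
    have h1 := (hplus t).ne'
    have h2 := (hminus t).ne'
    rw [hprod]
    field_simp
    ring
  have hi1 : Continuous fun t => a * b / (a + c * Real.cos t) :=
    continuous_const.div (by fun_prop) fun t => (hplus t).ne'
  have hi2 : Continuous fun t => a * b / (a - c * Real.cos t) :=
    continuous_const.div (by fun_prop) fun t => (hminus t).ne'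
  rw [← intervalIntegral.integral_add (hi1.intervalIntegrable _ _) (hi2.intervalIntegrable _ _)]
  simp_rw [hadd]
  rw [intervalIntegral.integral_const_mul, integral_mul_div_sq_mul_sin_sq_add_sq_mul_cos_sq ha hb]
  ring
end

section
/- Let a, b > 0, c = √(a² + b²), and fix t₀ ∈ ℝ. Define the nodary C₁(t) = (g(t), f(t)) where g(t) = ∫_{t₀}^{t} √(c² cosh²(z) − a²) dz − c sinh(t)(c cosh(t) − a)/√(c² cosh²(t) − a²) and f(t) = b(c cosh(t) − a)/√(c² cosh²(t) − a²). Then C₁ is differentiable and ‖C₁'(t)‖ = ab/(c cosh(t) + a) for every t. -/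
/-- If `q = c² cosh² t - a²` is positive, then `(c cosh t - a) / √q` has derivative
`a c sinh t / (√q (c cosh t + a))`. -/
theorem hasDerivAt_cosh_sub_div_sqrt {a c t : ℝ} (hu : 0 < c * Real.cosh t - a)
    (hv : 0 < c * Real.cosh t + a) :
    HasDerivAt
      (fun t => (c * Real.cosh t - a) / Real.sqrt (c ^ 2 * Real.cosh t ^ 2 - a ^ 2))
      (a * c * Real.sinh t /
        (Real.sqrt (c ^ 2 * Real.cosh t ^ 2 - a ^ 2) * (c * Real.cosh t + a))) t := by
  have hq : 0 < c ^ 2 * Real.cosh t ^ 2 - a ^ 2 := by nlinarith [mul_pos hu hv]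
  have hQ := Real.sqrt_pos.2 hq
  have hsq := Real.sq_sqrt hq.le
  have h1 : HasDerivAt (fun t => c * Real.cosh t - a) (c * Real.sinh t) t :=
    ((Real.hasDerivAt_cosh t).const_mul c).sub_const a
  have h2 : HasDerivAt (fun t => c ^ 2 * Real.cosh t ^ 2 - a ^ 2)
      (c ^ 2 * (2 * Real.cosh t * Real.sinh t)) t := by
    simpa using (((Real.hasDerivAt_cosh t).pow 2).const_mul (c ^ 2)).sub_const (a ^ 2)
  refine (h1.div (h2.sqrt hq.ne') hQ.ne').congr_deriv ?_
  generalize Real.sqrt (c ^ 2 * Real.cosh t ^ 2 - a ^ 2) = Q at *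
  rw [div_eq_div_iff (by positivity) (by positivity)]
  field_simp
  linear_combination (c ^ 2 * Real.sinh t * Real.cosh t) * hsq

/-- The nodary `C₁`, the roulette of the focus of a hyperbola nearest the tangent line,
is differentiable with speed `ab/(c cosh t + a)`. -/
theorem nodary_C1_speed
    (a b c t₀ : ℝ) (ha : 0 < a) (hb : 0 < b) (hc : c = Real.sqrt (a ^ 2 + b ^ 2))
    (g f : ℝ → ℝ)
    (hg : g = fun t => (∫ z in t₀..t, Real.sqrt (c ^ 2 * Real.cosh z ^ 2 - a ^ 2)) -
      c * Real.sinh t * (c * Real.cosh t - a) / Real.sqrt (c ^ 2 * Real.cosh t ^ 2 - a ^ 2))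
    (hf : f = fun t => b * (c * Real.cosh t - a) / Real.sqrt (c ^ 2 * Real.cosh t ^ 2 - a ^ 2))
    (C₁ : ℝ → EuclideanSpace ℝ (Fin 2))
    (hC : C₁ = fun t => (WithLp.equiv 2 (Fin 2 → ℝ)).symm ![g t, f t]) :
    Differentiable ℝ C₁ ∧ ∀ t : ℝ, ‖deriv C₁ t‖ = a * b / (c * Real.cosh t + a) := by
  have hc2 : c ^ 2 = a ^ 2 + b ^ 2 := by rw [hc, Real.sq_sqrt (by positivity)]
  have hac : a < c := by
    rw [hc]
    exact Real.lt_sqrt_of_sq_lt (by nlinarith [sq_pos_of_pos hb])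
  have hu (t : ℝ) : 0 < c * Real.cosh t - a := by nlinarith [Real.one_le_cosh t]
  have hv (t : ℝ) : 0 < c * Real.cosh t + a := by linarith [hu t]
  have hq (t : ℝ) : 0 < c ^ 2 * Real.cosh t ^ 2 - a ^ 2 := by
    nlinarith [mul_pos (hu t) (hv t)]
  have hf' (t : ℝ) : HasDerivAt f (a * b * (c * Real.sinh t) /
      (Real.sqrt (c ^ 2 * Real.cosh t ^ 2 - a ^ 2) * (c * Real.cosh t + a))) t := by
    simp only [hf, mul_div_assoc b]
    exact ((hasDerivAt_cosh_sub_div_sqrt (hu t) (hv t)).const_mul b).congr_deriv (by ring)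
  have hg' (t : ℝ) : HasDerivAt g (a * b * b /
      (Real.sqrt (c ^ 2 * Real.cosh t ^ 2 - a ^ 2) * (c * Real.cosh t + a))) t := by
    have hint : HasDerivAt
        (fun t => ∫ z in t₀..t, Real.sqrt (c ^ 2 * Real.cosh z ^ 2 - a ^ 2))
        (Real.sqrt (c ^ 2 * Real.cosh t ^ 2 - a ^ 2)) t :=
      (Continuous.integral_hasStrictDerivAt (by fun_prop) t₀ t).hasDerivAt
    have hprod := ((Real.hasDerivAt_sinh t).const_mul c).mul
      (hasDerivAt_cosh_sub_div_sqrt (hu t) (hv t))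
    simp only [hg, mul_div_assoc (c * Real.sinh _)]
    refine (hint.sub hprod).congr_deriv ?_
    have hQ := Real.sqrt_pos.2 (hq t)
    have hsq := Real.sq_sqrt (hq t).le
    have hv := hv t
    have hS := Real.cosh_sq t
    generalize Real.sqrt (c ^ 2 * Real.cosh t ^ 2 - a ^ 2) = Q at *
    field_simp
    linear_combination (c * Real.cosh t + a) * hsq + a * c ^ 2 * hS + a * hc2
  have hC' (t : ℝ) : HasDerivAt C₁ (WithLp.toLp 2 ![a * b * b /
      (Real.sqrt (c ^ 2 * Real.cosh t ^ 2 - a ^ 2) * (c * Real.cosh t + a)),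
      a * b * (c * Real.sinh t) /
      (Real.sqrt (c ^ 2 * Real.cosh t ^ 2 - a ^ 2) * (c * Real.cosh t + a))]) t := by
    have hpi : HasDerivAt (fun t => ![g t, f t]) ![a * b * b /
        (Real.sqrt (c ^ 2 * Real.cosh t ^ 2 - a ^ 2) * (c * Real.cosh t + a)),
        a * b * (c * Real.sinh t) /
        (Real.sqrt (c ^ 2 * Real.cosh t ^ 2 - a ^ 2) * (c * Real.cosh t + a))] t := by
      rw [hasDerivAt_pi, Fin.forall_fin_two]
      exact ⟨hg' t, hf' t⟩
    rw [hC]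
    exact (PiLp.hasFDerivAt_toLp 2 _).comp_hasDerivAt t hpi
  refine ⟨fun t => (hC' t).differentiableAt, fun t => ?_⟩
  have hQ := Real.sqrt_pos.2 (hq t)
  have hsq := Real.sq_sqrt (hq t).le
  have hv := hv t
  have hS := Real.cosh_sq t
  rw [(hC' t).deriv, EuclideanSpace.norm_eq, Real.sqrt_eq_iff_eq_sq (by positivity) (by positivity)]
  simp only [Fin.sum_univ_two, Real.norm_eq_abs, sq_abs, Matrix.cons_val_zero, Matrix.cons_val_one]
  generalize Real.sqrt (c ^ 2 * Real.cosh t ^ 2 - a ^ 2) = Q at *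
  field_simp
  linear_combination -hsq - c ^ 2 * hS - hc2
end

section
/- Let a, b > 0 and c = √(a² + b²). Then for all t₀ ≤ t, ∫_{t₀}^{t} ab/(c cosh(z) + a) dz = 2a arctan(√((c−a)/(c+a)) tanh(t/2)) − 2a arctan(√((c−a)/(c+a)) tanh(t₀/2)). -/
theorem Real.hasDerivAt_tanh_inv_cosh_sq (x : ℝ) :
    HasDerivAt Real.tanh (1 / Real.cosh x ^ 2) x := by
  have hx := (Real.cosh_pos x).ne'
  have h := (Real.hasDerivAt_sinh x).div (Real.hasDerivAt_cosh x) hx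
  have e : Real.tanh = Real.sinh / Real.cosh := by
    funext y
    exact Real.tanh_eq_sinh_div_cosh y
  rw [e]
  refine h.congr_deriv ?_
  rw [← Real.cosh_sq_sub_sinh_sq x]
  ring

theorem Real.hasDerivAt_arctan_mul_tanh_half {a b c : ℝ} (ha : 0 < a) (hc : 0 < c)
    (h : c ^ 2 = a ^ 2 + b ^ 2) (z : ℝ) :
    HasDerivAt (fun z => 2 * a * Real.arctan (b / (c + a) * Real.tanh (z / 2)))
      (a * b / (c * Real.cosh z + a)) z := by
  have ht : HasDerivAt (fun z : ℝ => Real.tanh (z / 2))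
      (1 / Real.cosh (z / 2) ^ 2 * (1 / 2)) z :=
    HasDerivAt.comp (h₂ := Real.tanh) (h := fun z : ℝ => z / 2) z
      (Real.hasDerivAt_tanh_inv_cosh_sq (z / 2)) ((hasDerivAt_id z).div_const 2)
  refine (((ht.const_mul (b / (c + a))).arctan).const_mul (2 * a)).congr_deriv ?_
  have hC := Real.cosh_pos (z / 2)
  have hcosh : Real.cosh z = Real.cosh (z / 2) ^ 2 + Real.sinh (z / 2) ^ 2 := by
    rw [← Real.cosh_two_mul]
    congr 1
    ring
  have hsq := Real.cosh_sq (z / 2)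
  have hden : c * Real.cosh z + a =
      (c + a) * (Real.cosh (z / 2) ^ 2 *
        (1 + (b / (c + a) * Real.tanh (z / 2)) ^ 2)) := by
    rw [hcosh, Real.tanh_eq_sinh_div_cosh]
    field_simp
    rw [show b ^ 2 = c ^ 2 - a ^ 2 by linarith, hsq]
    ring
  rw [hden]
  field_simp


/-- Arc length of the nodary `C₁`:
`∫_{t₀}^{t} ab/(c cosh z + a) dz = [2a arctan(√((c−a)/(c+a)) tanh(z/2))]_{t₀}^{t}`. -/
theorem nodary_C1_arclength
    (a b c : ℝ) (ha : 0 < a) (hb : 0 < b) (hc : c = Real.sqrt (a ^ 2 + b ^ 2)) :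
    ∀ t₀ t : ℝ, t₀ ≤ t →
      (∫ z in t₀..t, a * b / (c * Real.cosh z + a)) =
        2 * a * Real.arctan (Real.sqrt ((c - a) / (c + a)) * Real.tanh (t / 2)) -
          2 * a * Real.arctan (Real.sqrt ((c - a) / (c + a)) * Real.tanh (t₀ / 2)) := by
  intro t₀ t _
  have hsq : c ^ 2 = a ^ 2 + b ^ 2 := by
    rw [hc, Real.sq_sqrt (by positivity)]
  have hc0 : 0 < c := by
    rw [hc]
    positivity
  have hk : Real.sqrt ((c - a) / (c + a)) = b / (c + a) := by
    rw [show (c - a) / (c + a) = (b / (c + a)) ^ 2 by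
      field_simp
      linarith]
    exact Real.sqrt_sq (by positivity)
  rw [hk]
  refine intervalIntegral.integral_eq_sub_of_hasDerivAt
    (fun z _ => Real.hasDerivAt_arctan_mul_tanh_half ha hc0 hsq z) ?_
  refine (continuous_const.div (by fun_prop) fun z => ?_).intervalIntegrable _ _
  have := Real.cosh_pos z
  positivity
end

section
/- Let a, b > 0 and c = √(a² + b²). Then ∫_{−∞}^{∞} ab/(c cosh(t) + a) dt = 4a arctan(√((c−a)/(c+a))) = 2a arctan(b/a). -/
open Real Set Filter Topology in
/-- The total length of the nodary in half-angle form, where `c ^ 2 = a ^ 2 + b ^ 2`. -/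
lemma integral_div_mul_cosh_add {a b c : ℝ} (ha : 0 < a) (hb : 0 < b) (hc : 0 < c)
    (h : c ^ 2 = a ^ 2 + b ^ 2) :
    ∫ t : ℝ, a * b / (c * cosh t + a) = 4 * a * arctan (b / (c + a)) := by
  have hderiv (t : ℝ) : HasDerivAt (fun t ↦ 2 * a * arctan ((c * exp t + a) / b))
      (a * b / (c * cosh t + a)) t := by
    have key := (((((Real.hasDerivAt_exp t).const_mul c).add_const a).div_const b).arctan).const_mul
      (2 * a)
    refine key.congr_deriv ?_
    rw [cosh_eq, exp_neg]
    have hE : 0 < c * ((exp t + (exp t)⁻¹) / 2) + a := by positivity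
    rw [eq_div_iff hE.ne']
    field_simp
    linear_combination h
  have hlim : Tendsto (fun t ↦ 2 * a * arctan ((c * exp t + a) / b)) atTop
      (𝓝 (2 * a * (π / 2))) := by
    refine Tendsto.const_mul _ ((tendsto_arctan_atTop.mono_right nhdsWithin_le_nhds).comp ?_)
    exact (tendsto_atTop_add_const_right _ a
      (tendsto_exp_atTop.const_mul_atTop hc)).atTop_div_const hb
  have hIoi := MeasureTheory.integral_Ioi_of_hasDerivAt_of_nonneg' (a := 0)
    (fun t _ ↦ hderiv t) (fun t _ ↦ by have := cosh_pos t; positivity) hlim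
  have habs := integral_comp_abs (f := fun t ↦ a * b / (c * cosh t + a))
  simp only [cosh_abs] at habs
  rw [habs, hIoi, ← inv_div (c + a) b, arctan_inv_of_pos (by positivity), exp_zero, mul_one]
  ring

/-- The total length of the nodary `C₁` over `t ∈ (−∞, ∞)` equals
`4a arctan(√((c−a)/(c+a)))`, which is the length `2a arctan(b/a)` of the corresponding
arc of the pedal circle. -/
theorem nodary_C1_total_length
    (a b c : ℝ) (ha : 0 < a) (hb : 0 < b) (hc : c = Real.sqrt (a ^ 2 + b ^ 2)) :
    (∫ t : ℝ, a * b / (c * Real.cosh t + a)) =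
        4 * a * Real.arctan (Real.sqrt ((c - a) / (c + a))) ∧
      4 * a * Real.arctan (Real.sqrt ((c - a) / (c + a))) = 2 * a * Real.arctan (b / a) := by
  have hc0 : 0 < c := hc ▸ Real.sqrt_pos.2 (by positivity)
  have h : c ^ 2 = a ^ 2 + b ^ 2 := by rw [hc, Real.sq_sqrt (by positivity)]
  have hsqrt : Real.sqrt ((c - a) / (c + a)) = b / (c + a) := by
    rw [Real.sqrt_eq_iff_mul_self_eq_of_pos (by positivity)]
    field_simp
    linear_combination -h
  have hlt : b / (c + a) < 1 := by
    rw [div_lt_one (by positivity)]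
    nlinarith
  have hpos : 0 < b / (c + a) := by positivity
  rw [hsqrt]
  refine ⟨integral_div_mul_cosh_add ha hb hc0 h, ?_⟩
  have htwo := Real.two_mul_arctan (by linarith) hlt
  have harg : 2 * (b / (c + a)) / (1 - (b / (c + a)) ^ 2) = b / a := by
    have hne : 1 - (b / (c + a)) ^ 2 ≠ 0 := by nlinarith
    rw [div_eq_div_iff hne ha.ne']
    field_simp
    linear_combination -h
  rw [harg] at htwo
  linear_combination 2 * a * htwo
end

section
/- Let a, b > 0, c = √(a² + b²), and fix t₀ ∈ ℝ. Define C₂(t) = (g(t), f(t)) where g(t) = ∫_{t₀}^{t} √(c² cosh²(z) − a²) dz − c sinh(t)(c cosh(t) + a)/√(c² cosh²(t) − a²) and f(t) = b(c cosh(t) + a)/√(c² cosh²(t) − a²). Then C₂ is differentiable and ‖C₂'(t)‖ = ab/(c cosh(t) − a) for every t. -/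
open Real in
theorem nodary_radicand_pos {a c : ℝ} (ha : 0 < a) (hac : a < c) (t : ℝ) :
    0 < c ^ 2 * cosh t ^ 2 - a ^ 2 := by
  nlinarith [mul_le_mul_of_nonneg_left (one_le_cosh t) (ha.trans hac).le,
    mul_pos (ha.trans hac) (cosh_pos t)]

open Real in
theorem hasDerivAt_nodary_radical {a c : ℝ} (ha : 0 < a) (hac : a < c) (t : ℝ) :
    HasDerivAt (fun t => √(c ^ 2 * cosh t ^ 2 - a ^ 2))
      (c ^ 2 * cosh t * sinh t / √(c ^ 2 * cosh t ^ 2 - a ^ 2)) t := by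
  have h := ((((hasDerivAt_cosh t).pow 2).const_mul (c ^ 2)).sub_const (a ^ 2)).sqrt
    (nodary_radicand_pos ha hac t).ne'
  refine h.congr_deriv ?_
  have := (sqrt_pos.2 (nodary_radicand_pos ha hac t)).ne'
  simp only [Pi.pow_apply]
  field_simp
  push_cast
  ring

open Real in
theorem hasDerivAt_nodary_ordinate {a c : ℝ} (b : ℝ) (ha : 0 < a) (hac : a < c) (t : ℝ) :
    HasDerivAt (fun t => b * (c * cosh t + a) / √(c ^ 2 * cosh t ^ 2 - a ^ 2))
      (-(a * b * (c * sinh t) * (c * cosh t + a)) / √(c ^ 2 * cosh t ^ 2 - a ^ 2) ^ 3) t := by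
  have hpos := sqrt_pos.2 (nodary_radicand_pos ha hac t)
  have hsq := sq_sqrt (nodary_radicand_pos ha hac t).le
  refine (((((hasDerivAt_cosh t).const_mul c).add_const a).const_mul b).div
    (hasDerivAt_nodary_radical ha hac t) hpos.ne').congr_deriv ?_
  set R := √(c ^ 2 * cosh t ^ 2 - a ^ 2)
  field_simp
  rw [hsq]
  ring

open Real in
theorem hasDerivAt_nodary_abscissa {a b c : ℝ} (t₀ : ℝ) (ha : 0 < a) (hac : a < c)
    (hc : c ^ 2 = a ^ 2 + b ^ 2) (t : ℝ) :
    HasDerivAt (fun t => (∫ z in t₀..t, √(c ^ 2 * cosh z ^ 2 - a ^ 2)) -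
        c * sinh t * (c * cosh t + a) / √(c ^ 2 * cosh t ^ 2 - a ^ 2))
      (-(a * b ^ 2 * (c * cosh t + a)) / √(c ^ 2 * cosh t ^ 2 - a ^ 2) ^ 3) t := by
  have hpos := sqrt_pos.2 (nodary_radicand_pos ha hac t)
  have hsq := sq_sqrt (nodary_radicand_pos ha hac t).le
  have hcont : Continuous fun z => √(c ^ 2 * cosh z ^ 2 - a ^ 2) := by fun_prop
  refine ((hcont.integral_hasStrictDerivAt t₀ t).hasDerivAt.sub
    ((((hasDerivAt_sinh t).const_mul c).mul
      (((hasDerivAt_cosh t).const_mul c).add_const a)).div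
    (hasDerivAt_nodary_radical ha hac t) hpos.ne')).congr_deriv ?_
  have hb : b ^ 2 = c ^ 2 - a ^ 2 := by linarith
  have hs := sinh_sq t
  simp only [Pi.mul_apply]
  set R := √(c ^ 2 * cosh t ^ 2 - a ^ 2)
  rw [hb]
  field_simp
  have h4 : R ^ 4 = (c ^ 2 * cosh t ^ 2 - a ^ 2) ^ 2 := by rw [← hsq]; ring
  ring_nf
  simp only [h4, hsq, hs]
  ring

/-- The nodary `C₂`, the roulette of the focus of a hyperbola farthest from the tangent
line, is differentiable with speed `ab/(c cosh t − a)`. -/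
theorem nodary_C2_speed
    (a b c t₀ : ℝ) (ha : 0 < a) (hb : 0 < b) (hc : c = Real.sqrt (a ^ 2 + b ^ 2))
    (g f : ℝ → ℝ)
    (hg : g = fun t => (∫ z in t₀..t, Real.sqrt (c ^ 2 * Real.cosh z ^ 2 - a ^ 2)) -
      c * Real.sinh t * (c * Real.cosh t + a) / Real.sqrt (c ^ 2 * Real.cosh t ^ 2 - a ^ 2))
    (hf : f = fun t => b * (c * Real.cosh t + a) / Real.sqrt (c ^ 2 * Real.cosh t ^ 2 - a ^ 2))
    (C₂ : ℝ → EuclideanSpace ℝ (Fin 2))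
    (hC : C₂ = fun t => (WithLp.equiv 2 (Fin 2 → ℝ)).symm ![g t, f t]) :
    Differentiable ℝ C₂ ∧ ∀ t : ℝ, ‖deriv C₂ t‖ = a * b / (c * Real.cosh t - a) := by
  have hc2 : c ^ 2 = a ^ 2 + b ^ 2 := by rw [hc, Real.sq_sqrt (by positivity)]
  have hac : a < c := by rw [hc]; exact Real.lt_sqrt_of_sq_lt (by nlinarith)
  have hderiv (t : ℝ) : HasDerivAt C₂ (WithLp.toLp 2
      ![-(a * b ^ 2 * (c * Real.cosh t + a)) / √(c ^ 2 * Real.cosh t ^ 2 - a ^ 2) ^ 3,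
        -(a * b * (c * Real.sinh t) * (c * Real.cosh t + a)) /
          √(c ^ 2 * Real.cosh t ^ 2 - a ^ 2) ^ 3]) t := by
    have hpi : HasDerivAt (fun t => ![g t, f t])
        ![-(a * b ^ 2 * (c * Real.cosh t + a)) / √(c ^ 2 * Real.cosh t ^ 2 - a ^ 2) ^ 3,
          -(a * b * (c * Real.sinh t) * (c * Real.cosh t + a)) /
            √(c ^ 2 * Real.cosh t ^ 2 - a ^ 2) ^ 3] t := by
      refine hasDerivAt_pi.2 (Fin.forall_fin_two.2 ⟨?_, ?_⟩)
      · rw [hg]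
        exact hasDerivAt_nodary_abscissa t₀ ha hac hc2 t
      · rw [hf]
        exact hasDerivAt_nodary_ordinate b ha hac t
    rw [hC]
    exact (EuclideanSpace.equiv (Fin 2) ℝ).symm.hasFDerivAt.comp_hasDerivAt t hpi
  refine ⟨fun t => (hderiv t).differentiableAt, fun t => ?_⟩
  have hR := nodary_radicand_pos ha hac t
  have hden : 0 < c * Real.cosh t - a := by
    nlinarith [mul_le_mul_of_nonneg_left (Real.one_le_cosh t) (ha.trans hac).le]
  have hnum : 0 < c * Real.cosh t + a := by linarith
  rw [(hderiv t).deriv, EuclideanSpace.norm_eq, Real.sqrt_eq_iff_eq_sq (by positivity)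
    (by positivity)]
  have hsq := Real.sq_sqrt hR.le
  have h6 : (√(c ^ 2 * Real.cosh t ^ 2 - a ^ 2) ^ 3) ^ 2 =
      ((c * Real.cosh t - a) * (c * Real.cosh t + a)) ^ 3 := by
    rw [← pow_mul, mul_comm 3 2, pow_mul, hsq]
    ring
  simp only [Fin.sum_univ_two, Real.norm_eq_abs, sq_abs, Matrix.cons_val_zero,
    Matrix.cons_val_one, div_pow, h6, neg_sq, mul_pow, Real.sinh_sq]
  have hb2 : b ^ 2 = c ^ 2 - a ^ 2 := by linarith
  field_simp
  rw [hb2]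
  ring
end

section
/- Let 0 < b < a and c = √(a² − b²). Set f(t) = b(a − c cos(t))/√(a² − c² cos²(t)) and let G(t) = ab²/((a + c cos(t))√(a² − c² cos²(t))) denote the derivative of the height function of the unduloid. Then for every t ∈ ℝ, twice the mean curvature of the unduloid equals 1/a: (f'(t)G'(t) − f''(t)G(t))/(f'(t)² + G(t)²)^{3/2} + G(t)/(f(t)√(f'(t)² + G(t)²)) = 1/a. In particular the unduloid has constant mean curvature H = 1/(2a), the reciprocal of the distance between the vertices of the generating ellipse. -/
/-- The unduloid has constant mean curvature `H = 1/(2a)`: twice its mean curvature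
equals `1/a`, the reciprocal of the distance between the vertices of the generating
ellipse. -/
theorem unduloid_constant_mean_curvature
    (a b c : ℝ) (hb : 0 < b) (hba : b < a) (hc : c = Real.sqrt (a ^ 2 - b ^ 2))
    (f G : ℝ → ℝ)
    (hf : f = fun t => b * (a - c * Real.cos t) / Real.sqrt (a ^ 2 - c ^ 2 * Real.cos t ^ 2))
    (hG : G = fun t => a * b ^ 2 /
      ((a + c * Real.cos t) * Real.sqrt (a ^ 2 - c ^ 2 * Real.cos t ^ 2))) :
    ∀ t : ℝ,
      (deriv f t * deriv G t - deriv (deriv f) t * G t) /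
          ((deriv f t) ^ 2 + (G t) ^ 2) ^ ((3 : ℝ) / 2) +
        G t / (f t * Real.sqrt ((deriv f t) ^ 2 + (G t) ^ 2)) = 1 / a := by
  have hc2 : c ^ 2 = a ^ 2 - b ^ 2 := by
    rw [hc]; exact Real.sq_sqrt (by nlinarith)
  have hx : ∀ t, |c * Real.cos t| < a := fun t => by
    refine abs_lt_of_sq_lt_sq ?_ (hb.trans hba).le
    nlinarith [Real.cos_sq_le_one t, mul_le_mul_of_nonneg_left (Real.cos_sq_le_one t) (sq_nonneg c)]
  have hp : ∀ t, 0 < a + c * Real.cos t := fun t => by linarith [(abs_lt.1 (hx t)).1]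
  have hm : ∀ t, 0 < a - c * Real.cos t := fun t => by linarith [(abs_lt.1 (hx t)).2]
  have hD : ∀ t, 0 < a ^ 2 - c ^ 2 * Real.cos t ^ 2 := fun t => by
    nlinarith [mul_pos (hp t) (hm t)]
  have hs : ∀ t, 0 < Real.sqrt (a ^ 2 - c ^ 2 * Real.cos t ^ 2) := fun t =>
    Real.sqrt_pos.2 (hD t)
  have hs2 : ∀ t, Real.sqrt (a ^ 2 - c ^ 2 * Real.cos t ^ 2) ^ 2 =
      a ^ 2 - c ^ 2 * Real.cos t ^ 2 := fun t => Real.sq_sqrt (hD t).le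
  have hds : ∀ t, HasDerivAt (fun t => Real.sqrt (a ^ 2 - c ^ 2 * Real.cos t ^ 2))
      (c ^ 2 * Real.cos t * Real.sin t / Real.sqrt (a ^ 2 - c ^ 2 * Real.cos t ^ 2)) t :=
    fun t => by
      have h := ((((Real.hasDerivAt_cos t).pow 2).const_mul (c ^ 2)).const_sub (a ^ 2)).sqrt
        (hD t).ne'
      refine h.congr_deriv ?_
      have := (hs t).ne'
      simp only [Pi.pow_apply]
      field_simp
      norm_num
      ring
  have hdf : deriv f = fun t => G t * (c * Real.sin t / b) := by
    funext t
    have h := ((((Real.hasDerivAt_cos t).const_mul c).const_sub a).const_mul b).div (hds t)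
      (hs t).ne'
    rw [hf, hG]
    refine h.deriv.trans ?_
    dsimp only
    have h1 := (hs t).ne'
    have h2 := (hp t).ne'
    have h3 := hs2 t
    generalize Real.sqrt (a ^ 2 - c ^ 2 * Real.cos t ^ 2) = s at *
    field_simp
    rw [h3]
    ring
  have hdG : ∀ t, DifferentiableAt ℝ G t := fun t => by
    rw [hG]
    exact (differentiableAt_const _).div
      ((((Real.differentiable_cos t).const_mul c).const_add a).mul (hds t).differentiableAt)
      (mul_pos (hp t) (hs t)).ne'
  intro t
  have ha : 0 < a := hb.trans hba
  have hddf : deriv (deriv f) t =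
      deriv G t * (c * Real.sin t / b) + G t * (c * Real.cos t / b) := by
    rw [hdf]
    exact ((hdG t).hasDerivAt.mul
      (((Real.hasDerivAt_sin t).const_mul c).div_const b)).deriv
  have hspeed : deriv f t ^ 2 + G t ^ 2 = (a * b / (a + c * Real.cos t)) ^ 2 := by
    have h1 := (hs t).ne'
    have h2 := (hp t).ne'
    have h3 := hs2 t
    rw [hdf, hG]
    dsimp only
    generalize Real.sqrt (a ^ 2 - c ^ 2 * Real.cos t ^ 2) = s at *
    field_simp
    rw [h3, Real.sin_sq]
    linear_combination hc2
  have hv : 0 < a * b / (a + c * Real.cos t) := div_pos (mul_pos ha hb) (hp t)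
  have hpow : ((a * b / (a + c * Real.cos t)) ^ 2) ^ ((3 : ℝ) / 2) =
      (a * b / (a + c * Real.cos t)) ^ 3 := by
    rw [← Real.rpow_natCast_mul hv.le, ← Real.rpow_natCast _ 3]
    norm_num
  have hnum : deriv f t * deriv G t - deriv (deriv f) t * G t =
      -(G t ^ 2 * (c * Real.cos t / b)) := by
    rw [hddf, hdf]
    ring
  rw [hnum, hspeed, hpow, Real.sqrt_sq hv.le, hf, hG]
  dsimp only
  have h1 := (hs t).ne'
  have h2 := (hp t).ne'
  have h3 := hs2 t
  have h4 := (hm t).ne'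
  generalize Real.sqrt (a ^ 2 - c ^ 2 * Real.cos t ^ 2) = s at *
  field_simp
  rw [h3]
  ring
end

section
/- Let 0 < b < a and c = √(a² − b²). Set f(t) = b(a − c cos(t))/√(a² − c² cos²(t)) and G(t) = ab²/((a + c cos(t))√(a² − c² cos²(t))). Then for every t ∈ ℝ the Gaussian curvature of the unduloid satisfies G(t)(f'(t)G'(t) − f''(t)G(t)) / (f(t)(f'(t)² + G(t)²)²) = −c cos(t) / (a (a − c cos(t))²). -/
/-- The Gaussian curvature of the unduloid is `−c cos(t) / (a (a − c cos t)²)`. -/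
theorem unduloid_gaussian_curvature
    (a b c : ℝ) (hb : 0 < b) (hba : b < a) (hc : c = Real.sqrt (a ^ 2 - b ^ 2))
    (f G : ℝ → ℝ)
    (hf : f = fun t => b * (a - c * Real.cos t) / Real.sqrt (a ^ 2 - c ^ 2 * Real.cos t ^ 2))
    (hG : G = fun t => a * b ^ 2 /
      ((a + c * Real.cos t) * Real.sqrt (a ^ 2 - c ^ 2 * Real.cos t ^ 2))) :
    ∀ t : ℝ,
      G t * (deriv f t * deriv G t - deriv (deriv f) t * G t) /
          (f t * ((deriv f t) ^ 2 + (G t) ^ 2) ^ 2) =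
        -(c * Real.cos t) / (a * (a - c * Real.cos t) ^ 2) := by
  have ha : 0 < a := hb.trans hba
  have hc2 : c ^ 2 = a ^ 2 - b ^ 2 := by
    rw [hc, Real.sq_sqrt (by nlinarith)]
  have hcos (t : ℝ) : |c * Real.cos t| < a := by
    refine abs_lt_of_sq_lt_sq ?_ ha.le
    nlinarith [mul_nonneg (sq_nonneg c) (sq_nonneg (Real.sin t)), Real.sin_sq_add_cos_sq t]
  have hplus (t : ℝ) : 0 < a + c * Real.cos t := by linarith [(abs_lt.1 (hcos t)).1]
  have hminus (t : ℝ) : 0 < a - c * Real.cos t := by linarith [(abs_lt.1 (hcos t)).2]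
  have hrad (t : ℝ) : 0 < a ^ 2 - c ^ 2 * Real.cos t ^ 2 := by
    nlinarith [mul_pos (hplus t) (hminus t)]
  have hGpos (t : ℝ) : 0 < G t := by
    have := hplus t
    have := Real.sqrt_pos.2 (hrad t)
    rw [hG]
    positivity
  have hGdiff : Differentiable ℝ G := by
    intro t
    have h₁ := (hplus t).ne'
    have h₂ := (hrad t).ne'
    have h₃ := (Real.sqrt_pos.2 (hrad t)).ne'
    rw [hG]
    fun_prop (disch := first | assumption | exact mul_ne_zero h₁ h₃)
  -- The profile curve satisfies `b f' = c sin t · G`.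
  have hderiv : deriv f = fun t => c * Real.sin t / b * G t := by
    funext t
    have hW := Real.sqrt_pos.2 (hrad t)
    have hW2 := Real.sq_sqrt (hrad t).le
    have hnum : HasDerivAt (fun t => b * (a - c * Real.cos t)) (b * (c * Real.sin t)) t := by
      refine ((((Real.hasDerivAt_cos t).const_mul c).const_sub a).const_mul b).congr_deriv ?_
      ring
    have hden : HasDerivAt (fun t => a ^ 2 - c ^ 2 * Real.cos t ^ 2)
        (2 * c ^ 2 * Real.cos t * Real.sin t) t := by
      refine ((((Real.hasDerivAt_cos t).fun_pow 2).const_mul (c ^ 2)).const_sub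
        (a ^ 2)).congr_deriv ?_
      norm_num
      ring
    have h := hnum.fun_div (hden.sqrt (hrad t).ne') hW.ne'
    rw [hf, h.deriv, hG]
    beta_reduce
    have hp := (hplus t).ne'
    set W := Real.sqrt (a ^ 2 - c ^ 2 * Real.cos t ^ 2)
    field_simp
    rw [hW2]
    ring
  have hderiv2 (t : ℝ) : deriv (deriv f) t =
      (c * Real.cos t * G t + c * Real.sin t * deriv G t) / b := by
    rw [hderiv]
    have h := (((Real.hasDerivAt_sin t).const_mul c).div_const b).fun_mul (hGdiff t).hasDerivAt
    rw [h.deriv]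
    ring
  intro t
  have hW := Real.sqrt_pos.2 (hrad t)
  have hW2 := Real.sq_sqrt (hrad t).le
  have hp := hplus t
  have hm := hminus t
  have hnum : deriv f t * deriv G t - deriv (deriv f) t * G t =
      -(c * Real.cos t) * G t ^ 2 / b := by
    rw [hderiv2, hderiv]
    ring
  have hspeed : deriv f t ^ 2 + G t ^ 2 =
      G t ^ 2 * ((a + c * Real.cos t) * (a - c * Real.cos t)) / b ^ 2 := by
    rw [hderiv]
    field_simp
    linear_combination G t ^ 2 * (c ^ 2 * Real.sin_sq_add_cos_sq t + hc2)
  have hfG : f t * G t = a * b ^ 3 / (a + c * Real.cos t) ^ 2 := by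
    rw [hf, hG]
    beta_reduce
    set W := Real.sqrt (a ^ 2 - c ^ 2 * Real.cos t ^ 2)
    field_simp
    rw [hW2]
    ring
  have hft : f t = a * b ^ 3 / (a + c * Real.cos t) ^ 2 / G t :=
    eq_div_of_mul_eq (hGpos t).ne' hfG
  have hg := (hGpos t).ne'
  rw [hnum, hspeed, hft]
  field_simp
end
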